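/- arXiv:2312.05922 — 5 statements merged into one kernel-verified Lean document; each statement's English description precedes it below -/
import Mathlib

section
/- Let R be a commutative ring, V an R-module, and d, P : V → V R-linear maps with d ∘ d = 0 such that π := id + d∘P + P∘d satisfies π ∘ π = π (i.e., P is a homotopy operator). Define P₂ := (π − id) ∘ P ∘ (π − id) and P₃ := −P₂ ∘ d ∘ P₂. Then: (a) d∘P₃ + P₃∘d = π − id, so P₃ is a homotopy operator with respect to the same projection π; (b) P₃ ∘ P₃ = 0; (c) P₃ ∘ d ∘ P₃ = −P₃; that is, P₃ is a special homotopy operator with respect to π. Moreover, if ε : V → V is a linear involution (ε∘ε = id) with ε∘d = −d∘ε and ε∘P = −P∘ε (the grading involution acting by (−1)^degree), and B : V → V → R is an R-bilinear map satisfying B(d x, y) = −B(ε x, d y) and B(P x, y) = B(ε x, P y) for all x, y (so P is a propagator, i.e. symmetric with respect to the pairing), then also B(P₃ x, y) = B(ε x, P₃ y) for all x, y; that is, P₃ is a propagator with respect to the same projection π. -/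
/-- The ring-theoretic core of the construction. -/
theorem special_aux {A : Type*} [Ring A] (d P q p : A) (hd : d * d = 0)
    (hq : q = d * P + P * d) (hqq : q * q = -q) (hp : p = q * (P * q)) :
    (d * (-(p * (d * p))) + (-(p * (d * p))) * d = q) ∧
    ((-(p * (d * p))) * (-(p * (d * p))) = 0) ∧
    ((-(p * (d * p))) * (d * (-(p * (d * p)))) = -(-(p * (d * p)))) := by
  have hdq : d * q = q * d := by
    rw [hq, mul_add, add_mul, ← mul_assoc, hd, mul_assoc P, hd, mul_assoc]
    simp
  have hqp : q * p = -p := by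
    rw [hp, ← mul_assoc, hqq, neg_mul]
  have hpq : p * q = -p := by
    rw [hp, mul_assoc, mul_assoc, hqq]; simp
  have hsum : d * p + p * d = q := by
    have : d * p + p * d = q * (d * P + P * d) * q := by
      have h1 : d * p = q * (d * P) * q := by
        rw [hp, ← mul_assoc, hdq]; simp only [mul_assoc]
      have h2 : p * d = q * (P * d) * q := by
        rw [hp]; simp only [mul_assoc]; rw [← hdq]
      rw [h1, h2]; simp only [mul_add, add_mul]
    rw [this, ← hq, hqq, neg_mul, hqq, neg_neg]
  have hdp : d * p = q - p * d := by rw [← hsum]; abel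
  have hdpd : d * p * d = q * d := by
    rw [hdp, sub_mul, mul_assoc p, hd]; simp
  have hpdpd : p * (d * (p * d)) = -(p * d) := by
    rw [← mul_assoc d, hdpd, ← mul_assoc, hpq, neg_mul]
  have hdpdp : d * (p * (d * p)) = -(d * p) := by
    rw [← mul_assoc p, ← mul_assoc, ← mul_assoc, hdpd, mul_assoc, ← mul_assoc, ← hdq,
      mul_assoc, hqp, mul_neg]
  have hdppd : d * (p * (p * d)) = 0 := by
    rw [← mul_assoc, hdp, sub_mul, ← mul_assoc q, hqp, mul_assoc p, hpdpd]; simp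
  refine ⟨?_, ?_, ?_⟩
  · rw [mul_neg, hdpdp, neg_mul, mul_assoc, mul_assoc, hpdpd, neg_neg, neg_neg, hsum]
  · have : p * (d * p) * (p * (d * p)) = p * (d * (p * (p * d))) * p := by
      simp only [mul_assoc]
    rw [neg_mul_neg, this, hdppd]; simp
  · rw [mul_neg, hdpdp, neg_neg, neg_mul, mul_assoc, mul_assoc, hdpdp, mul_neg]

/-- Any propagator can be modified to a special propagator with respect to the
same projection (Cattaneo–Mnev): given a homotopy operator `P` (i.e.
`π := id + d∘P + P∘d` is a projection), the map `P₃ := -P₂ ∘ d ∘ P₂` with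
`P₂ := (π - id) ∘ P ∘ (π - id)` is a special homotopy operator with respect to
`π`; moreover if `P` is symmetric with respect to a pairing `B` (with grading
involution `ε`), then so is `P₃`. -/
theorem special_propagator_modification
    {R : Type*} [CommRing R] {V : Type*} [AddCommGroup V] [Module R V]
    (d P : V →ₗ[R] V) (hd : d ∘ₗ d = 0)
    (π : V →ₗ[R] V) (hπ : π = LinearMap.id + d ∘ₗ P + P ∘ₗ d)
    (hproj : π ∘ₗ π = π)
    (P₂ P₃ : V →ₗ[R] V)
    (hP₂ : P₂ = (π - LinearMap.id) ∘ₗ P ∘ₗ (π - LinearMap.id))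
    (hP₃ : P₃ = -(P₂ ∘ₗ d ∘ₗ P₂)) :
    (d ∘ₗ P₃ + P₃ ∘ₗ d = π - LinearMap.id) ∧
    (P₃ ∘ₗ P₃ = 0) ∧
    (P₃ ∘ₗ d ∘ₗ P₃ = -P₃) ∧
    (∀ ε : V →ₗ[R] V, ε ∘ₗ ε = LinearMap.id →
      ε ∘ₗ d = -(d ∘ₗ ε) → ε ∘ₗ P = -(P ∘ₗ ε) →
      ∀ B : V →ₗ[R] V →ₗ[R] R,
        (∀ x y : V, B (d x) y = -(B (ε x) (d y))) →
        (∀ x y : V, B (P x) y = B (ε x) (P y)) →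
        ∀ x y : V, B (P₃ x) y = B (ε x) (P₃ y)) := by
  have hq : π - LinearMap.id = d ∘ₗ P + P ∘ₗ d := by rw [hπ]; abel
  have hqq : (π - LinearMap.id) ∘ₗ (π - LinearMap.id) = -(π - LinearMap.id) := by
    rw [LinearMap.sub_comp, LinearMap.comp_sub, LinearMap.comp_sub, hproj]
    simp
  obtain ⟨h1, h2, h3⟩ :=
    special_aux (A := Module.End R V) d P (π - LinearMap.id) P₂ hd hq hqq hP₂
  subst hP₃
  refine ⟨h1, h2, h3, ?_⟩
  intro ε hε hεd hεP B hBd hBP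
  generalize π - LinearMap.id = q at *
  have ee : ∀ x, ε (ε x) = x := fun x => LinearMap.congr_fun hε x
  have ed : ∀ x, ε (d x) = -d (ε x) := fun x => LinearMap.congr_fun hεd x
  have eP : ∀ x, ε (P x) = -P (ε x) := fun x => LinearMap.congr_fun hεP x
  have qx : ∀ x, q x = d (P x) + P (d x) := fun x => LinearMap.congr_fun hq x
  have px : ∀ x, P₂ x = q (P (q x)) := fun x => LinearMap.congr_fun hP₂ x
  have eq : ∀ x, ε (q x) = q (ε x) := fun x => by simp [qx, ed, eP]
  have ep : ∀ x, ε (P₂ x) = -P₂ (ε x) := fun x => by simp [px, eq, eP]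
  have Bq : ∀ x y, B (q x) y = B x (q y) := fun x y => by
    simp [qx, hBd, hBP, ed, eP, ee, add_comm]
  have Bp : ∀ x y, B (P₂ x) y = B (ε x) (P₂ y) := fun x y => by
    rw [px, px, Bq, hBP, eq, Bq]
  intro x y
  simp [Bp, hBd, ed, ep, ee]
end

section
/- Let n be an integer and let V : ℤ → (real vector spaces) be a family with V i = 0 for all i < 0. Suppose that for every integer i there is an ℝ-bilinear map B_i : V i × V (n−i) → ℝ such that the induced linear map from V i to the dual space of V (n−i), sending x to B_i(x, ·), is bijective (a perfect pairing of degree n). Then V i = 0 for all i > n, and V i is finite-dimensional for every i; in particular the total graded space is finite-dimensional. -/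
/-- A nonnegatively graded real vector space with a perfect pairing of degree `n`
is concentrated in degrees `0, …, n` and is finite dimensional in each degree
(hence finite dimensional in total). -/
theorem nonneg_graded_perfect_pairing_finite_dimensional
    (n : ℤ) (V : ℤ → Type*)
    [∀ i, AddCommGroup (V i)] [∀ i, Module ℝ (V i)]
    (hneg : ∀ i : ℤ, i < 0 → Subsingleton (V i))
    (B : ∀ i : ℤ, V i →ₗ[ℝ] V (n - i) →ₗ[ℝ] ℝ)
    (hperfect : ∀ i : ℤ, Function.Bijective (B i)) :
    (∀ i : ℤ, n < i → Subsingleton (V i)) ∧ (∀ i : ℤ, FiniteDimensional ℝ (V i)) := by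
  constructor
  · intro i hi
    have := hneg (n - i) (by omega)
    have hs : Subsingleton (V (n - i) →ₗ[ℝ] ℝ) :=
      ⟨fun f g => LinearMap.ext fun x => by rw [Subsingleton.elim x 0, map_zero, map_zero]⟩
    exact (hperfect i).injective.subsingleton
  · have key : ∀ i j : ℤ, j = n - i → Module.rank ℝ (V i) = Module.rank ℝ (Module.Dual ℝ (V j)) := by
      rintro i j rfl
      exact (LinearEquiv.ofBijective (B i) (hperfect i)).rank_eq
    have lt : ∀ i : ℤ, Cardinal.aleph0 ≤ Module.rank ℝ (V i) →
        Module.rank ℝ (V i) < Module.rank ℝ (V (n - i)) := by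
      intro i h
      rw [key (n - i) i (by omega)]
      have := lift_rank_lt_rank_dual h
      simpa using this
    intro i
    by_contra hi
    have h : Cardinal.aleph0 ≤ Module.rank ℝ (V i) := by
      by_contra hlt
      exact hi (Module.rank_lt_aleph0_iff.mp (not_le.mp hlt))
    have h1 := lt i h
    have h2 := lt (n - i) (h.trans h1.le)
    rw [sub_sub_cancel] at h2
    exact lt_asymm h1 h2
end

section
/- Let V be a real vector space, d : V → V a linear map with d ∘ d = 0, and B : V → V → ℝ a bilinear form which is reflexive (B x y = 0 implies B y x = 0) and satisfies B (d x) y = 0 for all x ∈ V and all y with d y = 0 (the image of d is orthogonal to the kernel of d). Let ℋ ⊆ ker d be a finite-dimensional subspace with ker d = im d ⊕ ℋ (an internal direct sum), and assume the induced pairing on homology is nondegenerate: every x ∈ ker d satisfying B x y = 0 for all y ∈ ker d lies in im d. Define ℋ^⊥ := {x ∈ V : B h x = 0 for all h ∈ ℋ}. Then: (i) V = ℋ ⊕ ℋ^⊥ (internal direct sum); (ii) ℋ^⊥ ∩ ker d = im d; (iii) the restriction of B to ℋ is nondegenerate; (iv) for every x ∈ ker d, writing x = h + c with h ∈ ℋ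 and c ∈ ℋ^⊥ according to (i), one has x − h ∈ im d (so the projection of V onto ℋ along ℋ^⊥ sends each closed element to a cohomologous harmonic element; it is a quasi-isomorphism). -/
open LinearMap

/-- The orthogonal complement of a subspace `H` with respect to a bilinear form
`B`: all vectors `x` with `B h x = 0` for every `h ∈ H`. -/
def perpSubmodule {V : Type*} [AddCommGroup V] [Module ℝ V]
    (B : V →ₗ[ℝ] V →ₗ[ℝ] ℝ) (H : Submodule ℝ V) : Submodule ℝ V where
  carrier := {x : V | ∀ h ∈ H, B h x = 0}
  add_mem' := by
    intro a b ha hb h hh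
    simp [map_add, ha h hh, hb h hh]
  zero_mem' := by
    intro h hh
    simp
  smul_mem' := by
    intro c a ha h hh
    simp [ha h hh]

/-- Lemma on harmonic subspaces: if `H` is a finite-dimensional complement of
`im d` inside `ker d` and the pairing descends nondegenerately to homology,
then `V = H ⊕ H^⊥`, `H^⊥ ∩ ker d = im d`, the pairing restricts
nondegenerately to `H`, and the projection onto `H` along `H^⊥` sends each
closed element to a cohomologous harmonic element. -/
theorem harmonic_subspace_decomposition
    {V : Type*} [AddCommGroup V] [Module ℝ V]
    (d : V →ₗ[ℝ] V) (hd : d ∘ₗ d = 0)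
    (B : V →ₗ[ℝ] V →ₗ[ℝ] ℝ)
    (hrefl : ∀ x y : V, B x y = 0 → B y x = 0)
    (horth : ∀ x y : V, d y = 0 → B (d x) y = 0)
    (H : Submodule ℝ V) (hHker : H ≤ ker d)
    [FiniteDimensional ℝ H]
    (hsum : range d ⊔ H = ker d)
    (hdisj : range d ⊓ H = ⊥)
    (hnondeg : ∀ x ∈ ker d, (∀ y ∈ ker d, B x y = 0) → x ∈ range d) :
    (H ⊔ perpSubmodule B H = ⊤ ∧ H ⊓ perpSubmodule B H = ⊥) ∧
    (perpSubmodule B H ⊓ ker d = range d) ∧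
    (∀ h ∈ H, (∀ h' ∈ H, B h h' = 0) → h = 0) ∧
    (∀ x ∈ ker d, ∀ h ∈ H, ∀ c ∈ perpSubmodule B H,
      x = h + c → x - h ∈ range d) := by
  have hdd : ∀ z, d (d z) = 0 := fun z => LinearMap.congr_fun hd z
  have key : ∀ x, (∀ h ∈ H, B h x = 0) → x ∈ ker d → x ∈ range d := by
    intro x hx hxk
    refine hnondeg x hxk fun y hy => hrefl _ _ ?_
    rw [← hsum] at hy
    obtain ⟨a, ⟨z, rfl⟩, h, hh, rfl⟩ := Submodule.mem_sup.1 hy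
    rw [map_add, LinearMap.add_apply, horth z x hxk, hx h hh, add_zero]
  have nd' : ∀ h ∈ H, (∀ h' ∈ H, B h' h = 0) → h = 0 := by
    intro h hh h0
    have hm : h ∈ range d ⊓ H := ⟨key h h0 (hHker hh), hh⟩
    rw [hdisj] at hm
    exact (Submodule.mem_bot ℝ).1 hm
  refine ⟨⟨?_, ?_⟩, ?_, ?_, ?_⟩
  · let T : H →ₗ[ℝ] Module.Dual ℝ H := (B.domRestrict₁₂ H H).flip
    have hT : Function.Injective T := by
      rw [injective_iff_map_eq_zero]
      intro h hh
      apply Subtype.ext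
      exact nd' h h.2 fun h' hh' => LinearMap.congr_fun hh ⟨h', hh'⟩
    have hs : Function.Surjective T :=
      (LinearMap.injective_iff_surjective_of_finrank_eq_finrank
        Subspace.dual_finrank_eq.symm).1 hT
    rw [eq_top_iff]
    intro x _
    obtain ⟨h, hh⟩ := hs ((B.flip x).domRestrict H)
    refine Submodule.mem_sup.2 ⟨h, h.2, x - h, ?_, by abel⟩
    intro h' hh'
    have e : B h' h = B h' x := LinearMap.congr_fun hh ⟨h', hh'⟩
    rw [map_sub, e, sub_self]
  · rw [eq_bot_iff]
    rintro h ⟨hh, hp⟩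
    exact (Submodule.mem_bot ℝ).2 (nd' h hh hp)
  · apply le_antisymm
    · rintro x ⟨hp, hk⟩
      exact key x hp hk
    · rintro _ ⟨z, rfl⟩
      exact ⟨fun h hh => hrefl _ _ (horth z h (hHker hh)), hdd z⟩
  · intro h hh h0
    exact nd' h hh fun h' hh' => hrefl _ _ (h0 h' hh')
  · intro x hx h hh c hc e
    have e' : x - h = c := by rw [e]; abel
    refine key _ ?_ (Submodule.sub_mem _ hx (hHker hh))
    rw [e']
    exact hc
end

section
/- Let V be a module over a commutative ring (in the paper, a real vector space), and let d, P, π : V → V be linear maps satisfying: d ∘ d = 0; d∘P + P∘d = π − id; the range of π is contained in ker d; P ∘ P = 0; and P ∘ d ∘ P = −P (so P is a special homotopy operator whose associated projection takes values in the closed elements). Then V decomposes as the internal direct sum V = ker d ⊕ im P; that is, ker d ∩ im P = 0 and ker d + im P = V. -/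
open LinearMap

/-- If `P` is a special homotopy operator (`P∘P = 0`, `P∘d∘P = -P`,
`d∘P + P∘d = π - id`) whose associated projection `π` takes values in the
closed elements, then `V = ker d ⊕ im P` as an internal direct sum. -/
theorem ker_d_oplus_im_P
    {R : Type*} [CommRing R] {V : Type*} [AddCommGroup V] [Module R V]
    (d P π : V →ₗ[R] V)
    (hd : d ∘ₗ d = 0)
    (hhom : d ∘ₗ P + P ∘ₗ d = π - LinearMap.id)
    (hπ : range π ≤ ker d)
    (hPP : P ∘ₗ P = 0)
    (hPdP : P ∘ₗ d ∘ₗ P = -P) :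
    ker d ⊓ range P = ⊥ ∧ ker d ⊔ range P = ⊤ := by
  constructor
  · rw [eq_bot_iff]
    rintro _ ⟨hy, x, rfl⟩
    have hy' : d (P x) = 0 := hy
    have h := LinearMap.congr_fun hPdP x
    simp only [LinearMap.comp_apply, LinearMap.neg_apply, hy', map_zero] at h
    exact (Submodule.mem_bot R).2 (neg_eq_zero.1 h.symm)
  · rw [eq_top_iff]
    intro x _
    have h := LinearMap.congr_fun hhom x
    simp only [LinearMap.comp_apply, LinearMap.add_apply, LinearMap.sub_apply,
      LinearMap.id_apply] at h
    refine Submodule.mem_sup.2 ⟨π x - d (P x), ?_, P (-(d x)), ⟨_, rfl⟩, ?_⟩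
    · have h1 : d (π x) = 0 := hπ ⟨x, rfl⟩
      have h2 : d (d (P x)) = 0 := LinearMap.congr_fun hd (P x)
      rw [LinearMap.mem_ker, map_sub, h1, h2, sub_zero]
    · rw [map_neg, ← sub_eq_add_neg, sub_sub, h, sub_sub_cancel]
end

section
/- Let J be a finite index set partitioned into two disjoint nonempty subsets J₁ and J₂, let n ≥ 1, and let Δ′ be a linear subspace of (ℝⁿ)^J. Suppose (w^k)_{k∈ℕ} is a sequence in Δ′ such that: (a) for each j ∈ J₁ and each k, the component w^k_j is nonzero, and the unit vectors w^k_j / ‖w^k_j‖ converge as k → ∞ to some vector λ_j ∈ ℝⁿ; and (b) ‖w^k|_{J₂}‖ / ‖w^k|_{J₁}‖ → 0 as k → ∞, where w^k|_{J_i} denotes the tuple of components of w^k indexed by J_i (so in particular w^k|_{J₁} ≠ 0). Then there exists z ∈ Δ′ with z ≠ 0, with z_j = 0 for every j ∈ J₂, and such that for each j ∈ J₁ either z_j = 0 or z_j = t_j λ_j for some real t_j > 0. -/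
open Filter

/-- Degenerate limits of blown-up sequences: if a sequence `w^k` in a linear
subspace `Δ' ⊆ (ℝⁿ)^J` has nonzero `J₁`-components whose directions converge,
and the `J₂`-part becomes negligible relative to the `J₁`-part, then `Δ'`
contains a nonzero element `z` vanishing on `J₂` whose `J₁`-components are zero
or positive multiples of the limit directions. -/
theorem hidden_face_degenerate_solution
    {J : Type*} [Fintype J] [DecidableEq J] (n : ℕ) (hn : 1 ≤ n)
    (J₁ J₂ : Finset J) (hdisj : Disjoint J₁ J₂) (hunion : J₁ ∪ J₂ = Finset.univ)
    (hJ₁ : J₁.Nonempty) (hJ₂ : J₂.Nonempty)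
    (Δ' : Submodule ℝ (J → EuclideanSpace ℝ (Fin n)))
    (w : ℕ → J → EuclideanSpace ℝ (Fin n))
    (hw : ∀ k : ℕ, w k ∈ Δ')
    (hnz : ∀ k : ℕ, ∀ j ∈ J₁, w k j ≠ 0)
    (lam : J → EuclideanSpace ℝ (Fin n))
    (hdir : ∀ j ∈ J₁,
      Tendsto (fun k : ℕ => (‖w k j‖)⁻¹ • w k j) atTop (nhds (lam j)))
    (hratio : Tendsto
      (fun k : ℕ =>
        Real.sqrt (∑ j ∈ J₂, ‖w k j‖ ^ 2) / Real.sqrt (∑ j ∈ J₁, ‖w k j‖ ^ 2))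
      atTop (nhds 0)) :
    ∃ z ∈ Δ', z ≠ 0 ∧ (∀ j ∈ J₂, z j = 0) ∧
      (∀ j ∈ J₁, z j = 0 ∨ ∃ t : ℝ, 0 < t ∧ z j = t • lam j) := by
  classical
  set s : ℕ → ℝ := fun k => Real.sqrt (∑ j ∈ J₁, ‖w k j‖ ^ 2) with hs
  have hsumpos : ∀ k, 0 < ∑ j ∈ J₁, ‖w k j‖ ^ 2 := fun k =>
    Finset.sum_pos (fun j hj => by have := norm_pos_iff.mpr (hnz k j hj); positivity) hJ₁
  have hspos : ∀ k, 0 < s k := fun k => Real.sqrt_pos.mpr (hsumpos k)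
  have hle : ∀ k, ∀ j ∈ J₁, ‖w k j‖ ≤ s k := fun k j hj =>
    Real.le_sqrt_of_sq_le
      (Finset.single_le_sum (f := fun j => ‖w k j‖ ^ 2) (fun i _ => by positivity) hj)
  let r : ℕ → J → ℝ := fun k j => if j ∈ J₁ then ‖w k j‖ / s k else 0
  have hrmem : ∀ k, r k ∈ Set.Icc (0 : J → ℝ) 1 := by
    intro k
    refine ⟨fun j => ?_, fun j => ?_⟩
    · by_cases hj : j ∈ J₁
      · simp only [r, hj, if_true, Pi.zero_apply]
        exact div_nonneg (norm_nonneg _) (hspos k).le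
      · simp [r, hj]
    · by_cases hj : j ∈ J₁
      · simp only [r, hj, if_true, Pi.one_apply]
        exact (div_le_one (hspos k)).mpr (hle k j hj)
      · simp [r, hj]
  obtain ⟨ρ, hρ, φ, hφ, hlim⟩ := isCompact_Icc.tendsto_subseq hrmem
  have hlimj : ∀ j, Tendsto (fun k => r (φ k) j) atTop (nhds (ρ j)) :=
    fun j => (tendsto_pi_nhds.mp hlim) j
  let z : J → EuclideanSpace ℝ (Fin n) := fun j => if j ∈ J₁ then ρ j • lam j else 0
  have hcov : ∀ j, j ∉ J₁ → j ∈ J₂ := fun j hj => by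
    have : j ∈ J₁ ∪ J₂ := by rw [hunion]; exact Finset.mem_univ j
    exact (Finset.mem_union.mp this).resolve_left hj
  have hlimz : Tendsto (fun k => (s (φ k))⁻¹ • w (φ k)) atTop (nhds z) := by
    rw [tendsto_pi_nhds]
    intro j
    by_cases hj : j ∈ J₁
    · have h1 := (hlimj j).smul ((hdir j hj).comp hφ.tendsto_atTop)
      have hz : z j = ρ j • lam j := by simp [z, hj]
      rw [hz]
      refine h1.congr fun k => ?_
      have hne : ‖w (φ k) j‖ ≠ 0 := norm_ne_zero_iff.mpr (hnz _ j hj)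
      simp only [r, hj, if_true, Function.comp, Pi.smul_apply, smul_smul]
      congr 1
      field_simp
    · have hz : z j = 0 := by simp [z, hj]
      rw [hz]
      refine squeeze_zero_norm (fun k => ?_) (hratio.comp hφ.tendsto_atTop)
      have hb : ‖w (φ k) j‖ ≤ Real.sqrt (∑ j ∈ J₂, ‖w (φ k) j‖ ^ 2) :=
        Real.le_sqrt_of_sq_le
          (Finset.single_le_sum (f := fun j => ‖w (φ k) j‖ ^ 2)
            (fun i _ => by positivity) (hcov j hj))
      rw [Pi.smul_apply, norm_smul, norm_inv, Real.norm_of_nonneg (hspos _).le,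
        inv_mul_eq_div]
      exact div_le_div_of_nonneg_right hb (hspos _).le
  have hzmem : z ∈ Δ' :=
    (Submodule.closed_of_finiteDimensional Δ').mem_of_tendsto hlimz
      (Eventually.of_forall fun k => Δ'.smul_mem _ (hw _))
  have hone : ∑ j ∈ J₁, ρ j ^ 2 = 1 := by
    have h1 : Tendsto (fun k => ∑ j ∈ J₁, r (φ k) j ^ 2) atTop (nhds (∑ j ∈ J₁, ρ j ^ 2)) :=
      tendsto_finsetSum _ fun j _ => (hlimj j).pow 2
    refine tendsto_nhds_unique h1 (tendsto_const_nhds.congr fun k => ?_)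
    have h2 : ∑ j ∈ J₁, r (φ k) j ^ 2 = ∑ j ∈ J₁, ‖w (φ k) j‖ ^ 2 / s (φ k) ^ 2 :=
      Finset.sum_congr rfl fun j hj => by simp only [r, hj, if_true, div_pow]
    have h3 : s (φ k) ^ 2 = ∑ j ∈ J₁, ‖w (φ k) j‖ ^ 2 := Real.sq_sqrt (hsumpos _).le
    rw [h2, ← Finset.sum_div, h3, div_self (hsumpos _).ne']
  have hlam : ∀ j ∈ J₁, ‖lam j‖ = 1 := fun j hj => by
    refine tendsto_nhds_unique (hdir j hj).norm (tendsto_const_nhds.congr fun k => ?_)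
    have hne : ‖w k j‖ ≠ 0 := norm_ne_zero_iff.mpr (hnz _ j hj)
    rw [norm_smul, norm_inv, norm_norm, inv_mul_cancel₀ hne]
  refine ⟨z, hzmem, fun h0 => ?_, fun j hj => ?_, fun j hj => ?_⟩
  · have : ∑ j ∈ J₁, ρ j ^ 2 = 0 := Finset.sum_eq_zero fun j hj => by
      have hzj : ρ j • lam j = 0 := by
        have := congrFun h0 j
        simpa only [z, hj, if_true, Pi.zero_apply] using this
      have := congrArg norm hzj
      rw [norm_smul, hlam j hj, mul_one, norm_zero, norm_eq_zero] at this
      rw [this]; norm_num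
    linarith
  · have : j ∉ J₁ := fun h => (Finset.disjoint_left.mp hdisj h) hj
    simp [z, this]
  · have hz : z j = ρ j • lam j := by simp [z, hj]
    rcases (show (0 : ℝ) ≤ ρ j from hρ.1 j).eq_or_lt with h | h
    · left; rw [hz, ← h, zero_smul]
    · exact Or.inr ⟨ρ j, h, hz⟩
end
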